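/- arXiv:1001.0619 — 3 statements merged into one kernel-verified Lean document; each statement's English description precedes it below -/
import Mathlib

section
/- (Gaussian elimination, Lemma 4.2.) Let 𝒟 be a pretriangulated category with binary biproducts. Let X, Y, Z, W be objects, let A : X ⟶ Z, B : Y ⟶ Z, C : X ⟶ W, D : Y ⟶ W be morphisms, and let f : X ⊞ Y ⟶ Z ⊞ W be the morphism with matrix components A, B, C, D (i.e. f = biprod.lift (biprod.desc A B) (biprod.desc C D)). Assume D is an isomorphism. If (X ⊞ Y, Z ⊞ W, E, f, g, h) is a distinguished triangle and (X, Z, E′, A − C ≫ D⁻¹ ≫ B, g′, h′) is a distinguished triangle, then E ≅ E′. In other words, the cone of f is isomorphic to the cone of A − B∘D⁻¹∘C : X → Z. -/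
open CategoryTheory CategoryTheory.Limits CategoryTheory.Pretriangulated

/-- Gaussian elimination: if `f : X ⊞ Y ⟶ Z ⊞ W` has matrix components `A, B, C, D`
with `D` an isomorphism, then any cone of `f` is isomorphic to any cone of
`A - C ≫ D⁻¹ ≫ B : X ⟶ Z`. -/
theorem gaussian_elimination
    (𝒟 : Type*) [Category 𝒟] [HasZeroObject 𝒟] [Preadditive 𝒟] [HasShift 𝒟 ℤ]
    [∀ n : ℤ, (shiftFunctor 𝒟 n).Additive] [Pretriangulated 𝒟] [HasBinaryBiproducts 𝒟]
    (X Y Z W E E' : 𝒟)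
    (A : X ⟶ Z) (B : Y ⟶ Z) (C : X ⟶ W) (D : Y ⟶ W) [IsIso D]
    (g : Z ⊞ W ⟶ E) (h : E ⟶ (X ⊞ Y)⟦(1 : ℤ)⟧)
    (g' : Z ⟶ E') (h' : E' ⟶ X⟦(1 : ℤ)⟧)
    (hT : Triangle.mk (biprod.lift (biprod.desc A B) (biprod.desc C D)) g h ∈
      distTriang 𝒟)
    (hT' : Triangle.mk (A - C ≫ inv D ≫ B) g' h' ∈ distTriang 𝒟) :
    Nonempty (E ≅ E') := by
  set f : X ⊞ Y ⟶ Z ⊞ W := biprod.lift (biprod.desc A B) (biprod.desc C D) with hf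
  set s : X ⟶ Z := A - C ≫ inv D ≫ B with hs
  let a : X ⟶ X ⊞ Y := biprod.lift (𝟙 X) (-(C ≫ inv D))
  let q : Z ⊞ W ⟶ Z := biprod.desc (𝟙 Z) (-(inv D ≫ B))
  have h_af : a ≫ f = s ≫ biprod.inl := by
    ext <;> simp [a, f, s, biprod.lift_desc, sub_eq_add_neg]
  have h_fq : f ≫ q = biprod.fst ≫ s := by
    ext <;> simp [q, f, s, biprod.lift_desc, sub_eq_add_neg]
  have h_fg : f ≫ g = 0 := comp_distTriang_mor_zero₁₂ _ hT
  have h_hf : h ≫ f⟦(1 : ℤ)⟧' = 0 := comp_distTriang_mor_zero₃₁ _ hT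
  obtain ⟨c, hc₁, hc₂⟩ : ∃ c : E' ⟶ E, g' ≫ c = biprod.inl ≫ g ∧
      h' ≫ a⟦(1 : ℤ)⟧' = c ≫ h :=
    complete_distinguished_triangle_morphism _ _ hT' hT a biprod.inl h_af.symm
  obtain ⟨d, hd₁, hd₂⟩ : ∃ d : E ⟶ E', g ≫ d = q ≫ g' ∧
      h ≫ (biprod.fst : X ⊞ Y ⟶ X)⟦(1 : ℤ)⟧' = d ≫ h' :=
    complete_distinguished_triangle_morphism _ _ hT hT' biprod.fst q h_fq
  have h_cd₁ : g' ≫ c ≫ d = g' := by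
    rw [reassoc_of% hc₁, hd₁]
    simp [q]
  have h_cd₂ : (c ≫ d) ≫ h' = h' := by
    rw [Category.assoc, ← hd₂, ← reassoc_of% hc₂, ← Functor.map_comp]
    simp [a]
  have h_iso : IsIso (c ≫ d) := by
    let φ : Triangle.mk s g' h' ⟶ Triangle.mk s g' h' :=
      { hom₁ := 𝟙 _
        hom₂ := 𝟙 _
        hom₃ := c ≫ d
        comm₁ := (Category.comp_id s).trans (Category.id_comp s).symm
        comm₂ := h_cd₁.trans (Category.id_comp g').symm
        comm₃ := by
          change h' ≫ (𝟙 X)⟦(1 : ℤ)⟧' = (c ≫ d) ≫ h'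
          rw [h_cd₂, CategoryTheory.Functor.map_id, Category.comp_id] }
    exact isIso₃_of_isIso₁₂ φ hT' hT' (inferInstanceAs (IsIso (𝟙 X)))
      (inferInstanceAs (IsIso (𝟙 Z)))
  have h_mono : Mono d := by
    refine Preadditive.mono_of_cancel_zero _ (fun {P} t ht => ?_)
    have h1 : (t ≫ h) ≫ (biprod.fst : X ⊞ Y ⟶ X)⟦(1 : ℤ)⟧' = 0 := by
      rw [Category.assoc, hd₂, reassoc_of% ht, zero_comp]
    have h2 : t ≫ h = ((t ≫ h) ≫ (biprod.snd : X ⊞ Y ⟶ Y)⟦(1 : ℤ)⟧') ≫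
        (biprod.inr : Y ⟶ X ⊞ Y)⟦(1 : ℤ)⟧' := by
      have h3 : (t ≫ h) ≫ (𝟙 (X ⊞ Y))⟦(1 : ℤ)⟧' = t ≫ h := by simp
      rw [← biprod.total, Functor.map_add, Functor.map_comp, Functor.map_comp,
        Preadditive.comp_add, ← Category.assoc, h1, zero_comp, zero_add] at h3
      simpa using h3.symm
    have h4 : ((t ≫ h) ≫ (biprod.snd : X ⊞ Y ⟶ Y)⟦(1 : ℤ)⟧') = 0 := by
      have hD : (biprod.inr : Y ⟶ X ⊞ Y) ≫ f ≫ biprod.snd = D := by simp [f]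
      rw [← cancel_mono (D⟦(1 : ℤ)⟧'), zero_comp, ← hD, Functor.map_comp, Functor.map_comp,
        ← Category.assoc, ← h2, Category.assoc, reassoc_of% h_hf, zero_comp, comp_zero]
    rw [h4, zero_comp] at h2
    obtain ⟨v, hv⟩ : ∃ v : P ⟶ Z ⊞ W, t = v ≫ g := Triangle.coyoneda_exact₃ _ hT t h2
    have h5 : (v ≫ q) ≫ g' = 0 := by
      rw [Category.assoc, ← hd₁, ← Category.assoc, ← hv, ht]
    obtain ⟨w, hw⟩ : ∃ w : P ⟶ X, v ≫ q = w ≫ s := Triangle.coyoneda_exact₂ _ hT' (v ≫ q) h5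
    have h6 : v = w ≫ a ≫ f + (v ≫ biprod.snd ≫ inv D ≫ biprod.inr) ≫ f := by
      have h7 : v ≫ biprod.fst = v ≫ q + v ≫ biprod.snd ≫ inv D ≫ B := by
        rw [← Preadditive.comp_add]
        congr 1
        ext <;> simp [q]
      rw [h_af]
      ext
      · rw [h7, hw]
        simp [f]
      · simp [f]
    rw [hv, h6]
    simp [h_fg]
  have : IsSplitEpi d := ⟨⟨inv (c ≫ d) ≫ c, by simp⟩⟩
  have : IsIso d := isIso_of_mono_of_isSplitEpi d
  exact ⟨asIso d⟩
end

section
/- (Cancellation law, equation (4.1).) Let k be a field and let 𝒞 be a k-linear additive category (preadditive with finite biproducts) which is idempotent complete and Hom-finite, i.e. for all objects X, Y the k-vector space Hom(X, Y) is finite dimensional. Then for any objects A, B, C of 𝒞, if A ⊞ B ≅ A ⊞ C then B ≅ C. -/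
open CategoryTheory CategoryTheory.Limits

/-- Fitting dichotomy in a finite-dimensional algebra without nontrivial idempotents. -/
lemma fitting_aux (k : Type*) [Field k] {R : Type*} [Ring R] [Algebra k R] [FiniteDimensional k R]
    (H : ∀ e : R, e * e = e → e = 0 ∨ e = 1) (a : R) : IsUnit a ∨ IsNilpotent a := by
  have hint : IsIntegral k a := Algebra.IsIntegral.isIntegral a
  obtain ⟨q, hq, hnd⟩ := Polynomial.exists_eq_pow_rootMultiplicity_mul_and_not_dvd
    (minpoly k a) (minpoly.ne_zero hint) 0
  generalize (minpoly k a).rootMultiplicity 0 = m at hq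
  simp only [map_zero, sub_zero] at hq hnd
  obtain ⟨n, hn⟩ : ∃ n, n = m + 1 := ⟨_, rfl⟩
  have hcop : IsCoprime (Polynomial.X ^ n : Polynomial k) q :=
    ((Polynomial.irreducible_X.coprime_iff_not_dvd).2 hnd).pow_left
  obtain ⟨u, v, huv⟩ := hcop
  have h0 : a ^ n * Polynomial.aeval a q = 0 := by
    have := minpoly.aeval k a
    rw [hq] at this
    rw [hn, pow_succ', mul_assoc]
    simp only [map_mul, map_pow, Polynomial.aeval_X] at this
    rw [this, mul_zero]
  have hc : ∀ p : Polynomial k, Commute (Polynomial.aeval a p) a := fun p => by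
    have := Polynomial.aeval_X (R := k) a
    rw [commute_iff_eq]
    nth_rw 2 [← this]
    nth_rw 3 [← this]
    rw [← map_mul, ← map_mul, mul_comm]
  have h1 : Polynomial.aeval a u * a ^ n + Polynomial.aeval a v * Polynomial.aeval a q = 1 := by
    have := congrArg (Polynomial.aeval a) huv
    simpa using this
  have h2 : a ^ n * (Polynomial.aeval a u * a ^ n) = a ^ n := by
    have h3 : Polynomial.aeval a v * Polynomial.aeval a q
        = Polynomial.aeval a q * Polynomial.aeval a v := by
      rw [← map_mul, mul_comm, map_mul]
    have := congrArg (a ^ n * ·) h1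
    simp only [mul_add, h3, mul_one] at this
    rwa [← mul_assoc (a ^ n) (Polynomial.aeval a q), h0, zero_mul, add_zero] at this
  rcases H (Polynomial.aeval a u * a ^ n) (by rw [mul_assoc, h2]) with he | he
  · right; exact ⟨n, by rw [← h2, he, mul_zero]⟩
  · left
    have hu : IsUnit (a ^ n) := ⟨⟨a ^ n, Polynomial.aeval a u, by
      rw [((hc u).pow_right n).eq.symm, he], he⟩, rfl⟩
    exact (isUnit_pow_iff (by omega)).1 hu

/-- The local case of cancellation. -/
lemma cancel_local {𝒞 : Type*} [Category 𝒞] [Preadditive 𝒞] [HasBinaryBiproducts 𝒞]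
    (A B C : 𝒞) (H : ∀ a : End A, IsUnit a ∨ IsNilpotent a)
    (φ : (A ⊞ B) ≅ (A ⊞ C)) : Nonempty (B ≅ C) := by
  let a : End A := biprod.inl ≫ φ.hom ≫ biprod.fst
  rcases H a with ha | ha
  · have : IsIso (biprod.inl ≫ φ.hom ≫ biprod.fst) := (isUnit_iff_isIso a).1 ha
    exact ⟨Biprod.isoElim φ⟩
  · let c : A ⟶ C := biprod.inl ≫ φ.hom ≫ biprod.snd
    let a' : End A := biprod.inl ≫ φ.inv ≫ biprod.fst
    let b' : C ⟶ A := biprod.inr ≫ φ.inv ≫ biprod.fst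
    let d : End A := c ≫ b'
    have h1 : a' * a + d = 1 := by
      change (biprod.inl ≫ φ.hom ≫ biprod.fst) ≫ (biprod.inl ≫ φ.inv ≫ biprod.fst) +
        (biprod.inl ≫ φ.hom ≫ biprod.snd) ≫ (biprod.inr ≫ φ.inv ≫ biprod.fst) = 𝟙 A
      have : biprod.inl ≫ φ.hom ≫ (biprod.fst ≫ biprod.inl + biprod.snd ≫ biprod.inr) ≫
          φ.inv ≫ biprod.fst = 𝟙 A := by
        rw [biprod.total]; simp
      simpa only [Preadditive.add_comp, Preadditive.comp_add, Category.assoc] using this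
    have hd : IsUnit d := by
      rcases H d with hd | hd
      · exact hd
      · have h2 : IsUnit (a' * a) := by
          rw [eq_sub_of_add_eq h1]; exact hd.isUnit_one_sub
        obtain ⟨w, hw⟩ := h2
        have h3 : (↑w⁻¹ * a') * a = 1 := by rw [mul_assoc, ← hw, Units.inv_mul]
        obtain ⟨n, hn⟩ := ha
        have h4 : ∀ m, (↑w⁻¹ * a') ^ m * a ^ m = 1 := by
          intro m
          induction m with
          | zero => simp
          | succ m ih =>
            rw [pow_succ, pow_succ', mul_assoc, ← mul_assoc _ a, h3, one_mul, ih]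
        have h5 : (1 : End A) = 0 := by rw [← h4 n, hn, mul_zero]
        have := subsingleton_of_zero_eq_one h5.symm
        exact isUnit_of_subsingleton d
    obtain ⟨w, hw⟩ := hd
    let wi : End A := ↑w⁻¹
    let y : C ⟶ A := b' ≫ wi
    have hy : c ≫ y = 𝟙 A := by
      have h6 : wi * d = 1 := by rw [← hw]; exact Units.inv_mul w
      have h7 : (c ≫ b') ≫ wi = 𝟙 A := h6
      simpa [y] using h7
    let ψ := φ ≪≫ Biprod.unipotentLower y
    have hψ : biprod.inl ≫ ψ.hom ≫ biprod.fst = (show End A from a + 1) := by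
      change biprod.inl ≫ (φ.hom ≫ (Biprod.unipotentLower y).hom) ≫ biprod.fst =
        biprod.inl ≫ φ.hom ≫ biprod.fst + 𝟙 A
      rw [← hy]
      simp [Biprod.unipotentLower, Biprod.ofComponents, c]
    have : IsIso (biprod.inl ≫ ψ.hom ≫ biprod.fst) := by
      rw [hψ]; exact (isUnit_iff_isIso _).1 ha.isUnit_add_one
    exact ⟨Biprod.isoElim ψ⟩

lemma finrank_end_lt (k : Type*) [Field k] {𝒞 : Type*} [Category 𝒞] [Preadditive 𝒞]
    [Linear k 𝒞] (hfin : ∀ X Y : 𝒞, FiniteDimensional k (X ⟶ Y)) {A Y : 𝒞}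
    (i : Y ⟶ A) (e : A ⟶ Y) (h : i ≫ e = 𝟙 Y) (hne : e ≫ i ≠ 𝟙 A) :
    Module.finrank k (Y ⟶ Y) < Module.finrank k (A ⟶ A) := by
  have := hfin A A
  let f : (Y ⟶ Y) →ₗ[k] (A ⟶ A) :=
    { toFun := fun x => e ≫ x ≫ i
      map_add' := by intros; simp
      map_smul' := by intros; simp }
  have hf : ∀ x, f x = e ≫ x ≫ i := fun _ => rfl
  have hinj : Function.Injective f := by
    intro x y hxy
    have h2 : ∀ x, i ≫ f x ≫ e = x := by
      intro x
      rw [hf]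
      simp only [Category.assoc, h, Category.comp_id]
      rw [← Category.assoc, h, Category.id_comp]
    rw [← h2 x, hxy, h2 y]
  rw [← LinearMap.finrank_range_of_inj hinj]
  apply Submodule.finrank_lt
  intro htop
  obtain ⟨x, hx⟩ : 𝟙 A ∈ LinearMap.range f := by rw [htop]; trivial
  rw [hf] at hx
  apply hne
  calc e ≫ i = (e ≫ i) ≫ (e ≫ x ≫ i) := by rw [hx, Category.comp_id]
    _ = e ≫ (i ≫ e) ≫ x ≫ i := by simp only [Category.assoc]
    _ = 𝟙 A := by rw [h, Category.id_comp, hx]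

lemma cancel_aux (k : Type*) [Field k] {𝒞 : Type*} [Category 𝒞] [Preadditive 𝒞]
    [Linear k 𝒞] [HasBinaryBiproducts 𝒞] [IsIdempotentComplete 𝒞]
    (hfin : ∀ X Y : 𝒞, FiniteDimensional k (X ⟶ Y)) (n : ℕ) :
    ∀ A : 𝒞, Module.finrank k (A ⟶ A) = n → ∀ B C : 𝒞, ((A ⊞ B) ≅ (A ⊞ C)) →
      Nonempty (B ≅ C) := by
  induction n using Nat.strong_induction_on with
  | _ n ih =>
  intro A hA B C φ
  by_cases H : ∀ e : End A, e * e = e → e = 0 ∨ e = 1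
  · have : FiniteDimensional k (End A) := hfin A A
    exact cancel_local A B C (fitting_aux k H) φ
  · push Not at H
    obtain ⟨p, hp', hp0', hp1'⟩ : ∃ p : A ⟶ A, p ≫ p = p ∧ p ≠ 0 ∧ p ≠ 𝟙 A := H
    have hq' : (𝟙 A - (p : A ⟶ A)) ≫ (𝟙 A - p) = 𝟙 A - p := by
      simp [Preadditive.sub_comp, Preadditive.comp_sub, hp']
    obtain ⟨Y, i, e, hie, hei⟩ := IsIdempotentComplete.idempotents_split A p hp'
    obtain ⟨Z, j, f, hjf, hfj⟩ := IsIdempotentComplete.idempotents_split A _ hq'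
    have hY := finrank_end_lt k hfin i e hie (by rw [hei]; exact hp1')
    have hZ := finrank_end_lt k hfin j f hjf (by
      rw [hfj]; intro h; exact hp0' (by simpa using h))
    have hif : i ≫ f = 0 := by
      calc i ≫ f = (i ≫ e) ≫ i ≫ f ≫ (j ≫ f) := by simp [hie, hjf]
        _ = i ≫ ((e ≫ i) ≫ (f ≫ j)) ≫ f := by simp only [Category.assoc]
        _ = 0 := by rw [hei, hfj, Preadditive.comp_sub, hp']; simp
    have hje : j ≫ e = 0 := by
      calc j ≫ e = (j ≫ f) ≫ j ≫ e ≫ (i ≫ e) := by simp [hie, hjf]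
        _ = j ≫ ((f ≫ j) ≫ (e ≫ i)) ≫ e := by simp only [Category.assoc]
        _ = 0 := by rw [hei, hfj, Preadditive.sub_comp, hp']; simp
    let θ : A ≅ Y ⊞ Z :=
      { hom := biprod.lift e f
        inv := biprod.desc i j
        hom_inv_id := by rw [biprod.lift_desc, hei, hfj]; simp
        inv_hom_id := by
          ext <;> simp [hie, hjf, hif, hje] }
    let Θ : ∀ X : 𝒞, A ⊞ X ≅ Y ⊞ (Z ⊞ X) := fun X =>
      biprod.mapIso θ (Iso.refl X) ≪≫ biprod.associator Y Z X
    obtain ⟨φ₁⟩ := ih _ (hA ▸ hY) Y rfl _ _ ((Θ B).symm ≪≫ φ ≪≫ Θ C)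
    exact ih _ (hA ▸ hZ) Z rfl _ _ φ₁

/-- Cancellation law: in a `k`-linear, additive, idempotent complete, Hom-finite
category, `A ⊞ B ≅ A ⊞ C` implies `B ≅ C`. -/
theorem biprod_cancel_left
    (k : Type*) [Field k] (𝒞 : Type*) [Category 𝒞] [Preadditive 𝒞]
    [Linear k 𝒞] [HasFiniteBiproducts 𝒞] [HasBinaryBiproducts 𝒞] [IsIdempotentComplete 𝒞]
    (hfin : ∀ X Y : 𝒞, FiniteDimensional k (X ⟶ Y))
    (A B C : 𝒞) (h : Nonempty ((A ⊞ B) ≅ (A ⊞ C))) :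
    Nonempty (B ≅ C) := by
  obtain ⟨φ⟩ := h
  exact cancel_aux k hfin _ A rfl B C φ
end

section
/- (Cancellation law, equation (4.2).) Let k be a field and let 𝒞 be a k-linear additive category which is idempotent complete and Hom-finite (every Hom-space is a finite-dimensional k-vector space), equipped with a shift by ℤ (an equivalence X ↦ X⟦1⟧). Assume that for every nonzero object X of 𝒞 and every integer m, X ≅ X⟦m⟧ implies m = 0. Let a : ℤ → ℕ be a finitely supported function which is not identically zero, let s be a finite set of integers containing the support of a, and let A, B be objects of 𝒞. If the biproduct ⊕_{j ∈ s} (A⟦j⟧)^{⊕ a(j)} is isomorphic to ⊕_{j ∈ s} (B⟦j⟧)^{⊕ a(j)}, then A ≅ B. (This is the statement that A ⊗_k V ≅ B ⊗_k V implies A ≅ B, for V a nonzero finite-dimensional graded k-vector space, where tensoring an object by a graded vector space means taking the direct sum of shifted copies with multiplicities the graded dimensions of V.) -/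
open CategoryTheory CategoryTheory.Limits

namespace ShiftCancel

theorem exists_idem (k R : Type*) [Field k] [Ring R] [Algebra k R] [FiniteDimensional k R] (f : R) :
    ∃ e : R, e * e = e ∧ (e = 1 → IsUnit f) ∧ (e = 0 → IsUnit (1 - f)) := by
  let S := Algebra.adjoin k {f}
  letI : CommRing S := Algebra.adjoinCommRingOfComm k (by simp)
  haveI : FiniteDimensional k S := inferInstanceAs (FiniteDimensional k (Subalgebra.toSubmodule S))
  haveI : IsArtinianRing S := IsArtinianRing.of_finite k S
  let x : S := ⟨f, Algebra.subset_adjoin rfl⟩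
  obtain ⟨n, y, hy⟩ := IsArtinian.exists_pow_succ_smul_dvd x (1 : S)
  simp only [smul_eq_mul, mul_one] at hy
  have hm : ∀ m : ℕ, x ^ n = x ^ n * (x * y) ^ m := by
    intro m
    induction m with
    | zero => simp
    | succ m ih =>
      have : x ^ n * (x * y) = x ^ n := by rw [← mul_assoc, ← pow_succ]; exact hy
      rw [pow_succ', ← mul_assoc, this]; exact ih
  have h1 : x ^ (n+1) = x ^ (n+1) * (x * y) ^ (n+1) := by
    conv_lhs => rw [pow_succ, hm (n+1)]
    ring
  have val_one : ((1 : S) : R) = 1 := rfl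
  have hxf : (x : R) = f := rfl
  refine ⟨((x * y) ^ (n+1) : S), ?_, ?_, ?_⟩
  · have : ((x * y) ^ (n+1) : S) * (x * y) ^ (n+1) = (x * y) ^ (n+1) := by
      have h2 : (x*y)^(n+1) * (x*y)^(n+1) = (x ^ (n+1) * (x * y) ^ (n+1)) * y^(n+1) := by ring
      rw [h2, ← h1, mul_pow]
    exact congrArg Subtype.val this
  · intro h
    have h' : x * (y * (x*y)^n) = 1 := by
      apply Subtype.ext
      rw [val_one, ← h]; congr 1; ring
    have h'' : (y * (x*y)^n) * x = 1 := by rw [mul_comm]; exact h'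
    exact ⟨⟨f, ((y * (x*y)^n : S) : R), congrArg Subtype.val h', congrArg Subtype.val h''⟩, rfl⟩
  · intro h
    have h' : ((x * y) ^ (n+1) : S) = 0 := Subtype.ext h
    rw [h', mul_zero] at h1
    have h3 : f ^ (n+1) = 0 := congrArg Subtype.val h1
    exact IsNilpotent.isUnit_one_sub ⟨_, h3⟩

section
variable {C : Type*} [Category C] [Preadditive C]

/-- Objects with local endomorphism ring. -/
def Loc (X : C) : Prop := ¬ IsZero X ∧ ∀ f g : X ⟶ X, f + g = 𝟙 X → IsIso f ∨ IsIso g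

/-- `X` is a retract of `Y`. -/
def Retr (X Y : C) : Prop := ∃ (i : X ⟶ Y) (p : Y ⟶ X), i ≫ p = 𝟙 X

/-- `Y` is a direct sum of `X` and `Z`. -/
def IsSum (Y X Z : C) : Prop := ∃ (i : X ⟶ Y) (p : Y ⟶ X) (j : Z ⟶ Y) (q : Y ⟶ Z),
  i ≫ p = 𝟙 X ∧ j ≫ q = 𝟙 Z ∧ i ≫ q = 0 ∧ j ≫ p = 0 ∧ p ≫ i + q ≫ j = 𝟙 Y

theorem Retr.of_isIso {X Y : C} (f : X ⟶ Y) (g : Y ⟶ X) (h : IsIso (f ≫ g)) : Retr X Y :=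
  ⟨f, g ≫ inv (f ≫ g), by rw [← Category.assoc]; simp⟩

theorem Retr.trans {X Y Z : C} (h : Retr X Y) (h' : Retr Y Z) : Retr X Z := by
  obtain ⟨i, p, h⟩ := h
  obtain ⟨i', p', h'⟩ := h'
  exact ⟨i ≫ i', p' ≫ p, by simp [reassoc_of% h', h]⟩

theorem Retr.of_iso {X Y : C} (e : X ≅ Y) : Retr X Y := ⟨e.hom, e.inv, by simp⟩

theorem IsSum.retr {Y X Z : C} (h : IsSum Y X Z) : Retr X Y := by
  obtain ⟨i, p, _, _, h, _⟩ := h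
  exact ⟨i, p, h⟩

theorem Retr.isSum [IsIdempotentComplete C] {X Y : C} (h : Retr X Y) : ∃ Z, IsSum Y X Z := by
  obtain ⟨i, p, h⟩ := h
  obtain ⟨Z, j, q, h1, h2⟩ := IsIdempotentComplete.idempotents_split Y (𝟙 Y - p ≫ i)
    (by simp [reassoc_of% h])
  refine ⟨Z, i, p, j, q, h, h1, ?_, ?_, by rw [h2]; simp⟩
  · have : i ≫ (q ≫ j) ≫ q = 0 := by rw [h2]; simp [reassoc_of% h]
    simpa [h1] using this
  · have : j ≫ (q ≫ j) ≫ p = 0 := by rw [h2]; simp [h]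
    simpa [reassoc_of% h1] using this

theorem IsSum.isoX {Y X Z X' : C} (h : IsSum Y X Z) (e : X ≅ X') : IsSum Y X' Z := by
  obtain ⟨i, p, j, q, h1, h2, h3, h4, h5⟩ := h
  exact ⟨e.inv ≫ i, p ≫ e.hom, j, q, by simp [reassoc_of% h1], h2, by simp [h3],
    by simp [reassoc_of% h4], by simpa using h5⟩

theorem IsSum.map {D : Type*} [Category D] [Preadditive D] (F : C ⥤ D) [F.Additive]
    {Y X Z : C} (h : IsSum Y X Z) : IsSum (F.obj Y) (F.obj X) (F.obj Z) := by
  obtain ⟨i, p, j, q, h1, h2, h3, h4, h5⟩ := h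
  refine ⟨F.map i, F.map p, F.map j, F.map q, ?_, ?_, ?_, ?_, ?_⟩
  · rw [← F.map_comp, h1, F.map_id]
  · rw [← F.map_comp, h2, F.map_id]
  · rw [← F.map_comp, h3, F.map_zero]
  · rw [← F.map_comp, h4, F.map_zero]
  · rw [← F.map_comp, ← F.map_comp, ← F.map_add, h5, F.map_id]

theorem IsSum.iso {Y Y' X Z Z' : C} (h : IsSum Y X Z) (h' : IsSum Y' X Z') (e : Z ≅ Z') :
    Nonempty (Y ≅ Y') := by
  obtain ⟨i, p, j, q, h1, h2, h3, h4, h5⟩ := h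
  obtain ⟨i', p', j', q', h1', h2', h3', h4', h5'⟩ := h'
  refine ⟨⟨p ≫ i' + q ≫ e.hom ≫ j', p' ≫ i + q' ≫ e.inv ≫ j, ?_, ?_⟩⟩
  · simp [reassoc_of% h1', reassoc_of% h2', reassoc_of% h3', reassoc_of% h4', h5]
  · simp [reassoc_of% h1, reassoc_of% h2, reassoc_of% h3, reassoc_of% h4, h5']

theorem Loc.iso_of_retr {X Y : C} (hX : ¬ IsZero X) (hY : Loc Y) (h : Retr X Y) :
    Nonempty (X ≅ Y) := by
  obtain ⟨i, p, h⟩ := h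
  rcases hY.2 (p ≫ i) (𝟙 Y - p ≫ i) (by simp) with h1 | h1
  · have h2 : p ≫ i = 𝟙 Y := by
      rw [← cancel_epi (p ≫ i)]; simp [reassoc_of% h]
    exact ⟨⟨i, p, h, h2⟩⟩
  · exfalso
    apply hX
    have h2 : i ≫ (𝟙 Y - p ≫ i) = 0 := by simp [reassoc_of% h]
    have h3 : i = 0 := by
      rw [← cancel_mono (𝟙 Y - p ≫ i), h2, zero_comp]
    rw [IsZero.iff_id_eq_zero, ← h, h3, zero_comp]

theorem Loc.of_iso {X Y : C} (hX : Loc X) (e : X ≅ Y) : Loc Y := by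
  refine ⟨fun h => hX.1 (h.of_iso e), fun f g h => ?_⟩
  have := hX.2 (e.hom ≫ f ≫ e.inv) (e.hom ≫ g ≫ e.inv) (by
    rw [← Preadditive.comp_add, ← Preadditive.add_comp, h]; simp)
  simpa using this

theorem Loc.map {D : Type*} [Category D] [Preadditive D] (F : C ⥤ D) [F.Additive] [F.Full]
    [F.Faithful] {X : C} (hX : Loc X) : Loc (F.obj X) := by
  refine ⟨fun h => hX.1 ?_, fun f g h => ?_⟩
  · rw [IsZero.iff_id_eq_zero] at h ⊢
    apply F.map_injective
    simpa using h
  · obtain ⟨f, rfl⟩ := F.map_surjective f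
    obtain ⟨g, rfl⟩ := F.map_surjective g
    rw [← F.map_add, ← F.map_id] at h
    rcases hX.2 f g (F.map_injective h) with h | h
    · left; infer_instance
    · right; infer_instance

theorem Retr.of_map {D : Type*} [Category D] [Preadditive D] (F : C ⥤ D) [F.Full]
    [F.Faithful] {X Y : C} (h : Retr (F.obj X) (F.obj Y)) : Retr X Y := by
  obtain ⟨i, p, h⟩ := h
  obtain ⟨i, rfl⟩ := F.map_surjective i
  obtain ⟨p, rfl⟩ := F.map_surjective p
  exact ⟨i, p, F.map_injective (by simpa using h)⟩

variable (k : Type*) [Field k] [Linear k C]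

/-- The radical of `Hom(X, Y)`. -/
def rad {X : C} (hX : Loc X) (Y : C) : Submodule k (X ⟶ Y) where
  carrier := {f | ∀ g : Y ⟶ X, ¬ IsIso (f ≫ g)}
  zero_mem' := by
    intro g h
    apply hX.1
    rw [zero_comp] at h
    rw [IsZero.iff_id_eq_zero, ← cancel_epi (0 : X ⟶ X)]
    simp
  add_mem' := by
    intro f1 f2 h1 h2 g h
    rcases hX.2 (f1 ≫ g ≫ inv ((f1 + f2) ≫ g)) (f2 ≫ g ≫ inv ((f1 + f2) ≫ g)) (by
      rw [← Preadditive.add_comp, ← Category.assoc, IsIso.hom_inv_id]) with h | h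
    · exact h1 _ h
    · exact h2 _ h
  smul_mem' := by
    intro c f h g hg
    apply h (c • g)
    simpa using hg

theorem mem_rad {X : C} (hX : Loc X) {Y : C} (f : X ⟶ Y) :
    f ∈ rad k hX Y ↔ ∀ g : Y ⟶ X, ¬ IsIso (f ≫ g) := Iff.rfl

theorem rad_comp {X : C} (hX : Loc X) {Y Z : C} (f : X ⟶ Y) (hf : f ∈ rad k hX Y) (u : Y ⟶ Z) :
    f ≫ u ∈ rad k hX Z := by
  intro g h
  exact hf (u ≫ g) (by simpa using h)

/-- The dimension of `Hom(X, Y)` modulo the radical. -/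
noncomputable def dd {X : C} (hX : Loc X) (Y : C) : ℕ :=
  Module.finrank k ((X ⟶ Y) ⧸ rad k hX Y)

variable [hfin : ∀ X Y : C, FiniteDimensional k (X ⟶ Y)]

theorem dd_sum {X : C} (hX : Loc X) {J : Type*} [Fintype J] (Y : C) (Z : J → C)
    (ι : ∀ j, Z j ⟶ Y) (π : ∀ j, Y ⟶ Z j) (h1 : ∀ j, ι j ≫ π j = 𝟙 _)
    (h2 : ∀ j l, j ≠ l → ι j ≫ π l = 0) (h3 : ∑ j, π j ≫ ι j = 𝟙 Y) :
    dd k hX Y = ∑ j, dd k hX (Z j) := by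
  classical
  let φ : (X ⟶ Y) →ₗ[k] (∀ j, (X ⟶ Z j) ⧸ rad k hX (Z j)) :=
    LinearMap.pi fun j => (rad k hX (Z j)).mkQ ∘ₗ Linear.rightComp k X (π j)
  have hφ : ∀ f j, φ f j = (rad k hX (Z j)).mkQ (f ≫ π j) := fun f j => rfl
  have hker : LinearMap.ker φ = rad k hX Y := by
    ext f
    rw [LinearMap.mem_ker]
    constructor
    · intro h
      have h' : ∀ j, f ≫ π j ∈ rad k hX (Z j) := by
        intro j
        have := congrFun h j
        rw [hφ] at this
        simpa using this
      have : f = ∑ j, (f ≫ π j) ≫ ι j := by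
        conv_lhs => rw [← Category.comp_id f, ← h3, Preadditive.comp_sum]
        simp
      rw [this]
      exact Submodule.sum_mem _ fun j _ => rad_comp k hX _ (h' j) _
    · intro h
      funext j
      rw [hφ]
      simpa using rad_comp k hX _ h _
  have hsurj : Function.Surjective φ := by
    intro y
    choose g hg using fun j => (rad k hX (Z j)).mkQ_surjective (y j)
    refine ⟨∑ j, g j ≫ ι j, ?_⟩
    funext j
    rw [hφ, ← hg, Preadditive.sum_comp, Finset.sum_eq_single j]
    · simp [h1]
    · intro l _ hl; simp [h2 l j hl]
    · simp
  unfold dd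
  rw [← Module.finrank_pi_fintype, ← hker]
  exact (φ.quotKerEquivOfSurjective hsurj).finrank_eq

theorem dd_iso {X : C} (hX : Loc X) {Y Z : C} (e : Y ≅ Z) : dd k hX Y = dd k hX Z := by
  rw [dd_sum k hX (J := Unit) Y (fun _ => Z) (fun _ => e.inv) (fun _ => e.hom) (by simp)
    (fun j l h => (h rfl).elim) (by simp)]
  simp

theorem dd_isSum {X : C} (hX : Loc X) {Y Z W : C} (h : IsSum Y Z W) :
    dd k hX Y = dd k hX Z + dd k hX W := by
  obtain ⟨i, p, j, q, h1, h2, h3, h4, h5⟩ := h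
  rw [dd_sum k hX (J := Bool) Y (fun b => match b with | true => Z | false => W)
    (fun b => match b with | true => i | false => j)
    (fun b => match b with | true => p | false => q) ?_ ?_ ?_]
  · simp
  · rintro (_ | _) <;> assumption
  · rintro (_ | _) (_ | _) h <;> first | assumption | exact (h rfl).elim
  · simpa using h5

theorem dd_biproduct {X : C} (hX : Loc X) {J : Type} [Fintype J] (Z : J → C) [HasBiproduct Z] :
    dd k hX (⨁ Z) = ∑ j, dd k hX (Z j) := by
  classical
  exact dd_sum k hX _ Z (biproduct.ι Z) (biproduct.π Z) (by simp)
    (fun j l h => biproduct.ι_π_ne _ h) (biproduct.total)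

theorem dd_eq_zero {X : C} (hX : Loc X) {Y : C} : dd k hX Y = 0 ↔ ¬ Retr X Y := by
  unfold dd
  rw [Module.finrank_zero_iff, Submodule.Quotient.subsingleton_iff, Submodule.eq_top_iff']
  constructor
  · rintro h ⟨i, p, hip⟩
    exact h i p (by rw [hip]; infer_instance)
  · intro h f g hg
    exact h (Retr.of_isIso f g hg)

theorem dd_self {X : C} (hX : Loc X) : dd k hX X ≠ 0 := by
  rw [Ne, dd_eq_zero, not_not]
  exact Retr.of_iso (Iso.refl X)

theorem size_lt {Y X Z : C} (h : IsSum Y X Z) (hX : ¬ IsZero X) :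
    Module.finrank k (Z ⟶ Z) < Module.finrank k (Y ⟶ Y) := by
  obtain ⟨i, p, j, q, h1, h2, h3, h4, h5⟩ := h
  let φ : (Z ⟶ Z) →ₗ[k] (Y ⟶ Y) := Linear.leftComp k Y q ∘ₗ Linear.rightComp k Z j
  have hφ : ∀ f, φ f = q ≫ f ≫ j := fun f => rfl
  have hinj : Function.Injective φ := by
    intro f g h
    rw [hφ, hφ] at h
    have := congrArg (fun t => j ≫ t ≫ q) h
    simpa [reassoc_of% h2, h2] using this
  rw [← LinearMap.finrank_range_of_inj hinj]
  apply Submodule.finrank_lt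
  intro ht
  obtain ⟨f, hf⟩ := LinearMap.range_eq_top.1 ht (𝟙 Y)
  rw [hφ] at hf
  apply hX
  have : i = 0 := by rw [← Category.comp_id i, ← hf, reassoc_of% h3, zero_comp]
  rw [IsZero.iff_id_eq_zero, ← h1, this, zero_comp]

theorem IsSum.symm {Y X Z : C} (h : IsSum Y X Z) : IsSum Y Z X := by
  obtain ⟨i, p, j, q, h1, h2, h3, h4, h5⟩ := h
  exact ⟨j, q, i, p, h2, h1, h4, h3, by rw [add_comm]; exact h5⟩

include k in
theorem exists_loc [IsIdempotentComplete C] (Y : C) (hY : ¬ IsZero Y) :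
    ∃ X : C, Loc X ∧ Retr X Y := by
  induction hn : Module.finrank k (Y ⟶ Y) using Nat.strong_induction_on generalizing Y with
  | _ n ih =>
  by_cases hL : Loc Y
  · exact ⟨Y, hL, Retr.of_iso (Iso.refl Y)⟩
  have : ∃ f g : Y ⟶ Y, f + g = 𝟙 Y ∧ ¬ IsIso f ∧ ¬ IsIso g := by
    by_contra! hc
    exact hL ⟨hY, fun f g h => or_iff_not_imp_left.2 (hc f g h)⟩
  obtain ⟨f, g, hfg, hf, hg⟩ := this
  haveI : FiniteDimensional k (End Y) := hfin Y Y
  obtain ⟨e, he, he1, he0⟩ := exists_idem k (End Y) f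
  have he1 : e ≠ 1 := fun h => hf ((isUnit_iff_isIso _).1 (he1 h))
  have he0 : e ≠ 0 := fun h => hg (by
    have := (isUnit_iff_isIso _).1 (he0 h)
    have h' : g = 𝟙 Y - f := by rw [eq_sub_iff_add_eq, add_comm]; exact hfg
    rw [h']; exact this)
  obtain ⟨Z, i, p, h1, h2⟩ := IsIdempotentComplete.idempotents_split Y e he
  have hZ : Retr Z Y := ⟨i, p, h1⟩
  have hZ0 : ¬ IsZero Z := by
    intro h
    apply he0
    rw [← h2, h.eq_of_src i 0, comp_zero]
  obtain ⟨W, hW, hW0⟩ : ∃ W, IsSum Y Z W ∧ ¬ IsZero W := by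
    obtain ⟨W, j, q, h3, h4⟩ := IsIdempotentComplete.idempotents_split Y (𝟙 Y - p ≫ i)
      (by simp [reassoc_of% h1])
    refine ⟨W, ⟨i, p, j, q, h1, h3, ?_, ?_, by rw [h4]; simp⟩, ?_⟩
    · have : i ≫ (q ≫ j) ≫ q = 0 := by rw [h4]; simp [reassoc_of% h1]
      simpa [h3] using this
    · have : j ≫ (q ≫ j) ≫ p = 0 := by rw [h4]; simp [h1]
      simpa [reassoc_of% h3] using this
    · intro h
      apply he1
      rw [h.eq_of_src j 0, comp_zero, h2, eq_comm, sub_eq_zero] at h4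
      exact h4.symm
  obtain ⟨X, hX, hXZ⟩ := ih _ (hn ▸ size_lt k hW.symm hW0) Z hZ0 rfl
  exact ⟨X, hX, hXZ.trans hZ⟩

theorem dd_ratio [IsIdempotentComplete C] (F : C ⥤ C) [F.Additive] [F.Full] [F.Faithful]
    {X X' : C} (hX : Loc X) (hX' : Loc X') (e : F.obj X ≅ X') (Y : C) :
    dd k hX' (F.obj Y) * dd k hX X = dd k hX Y * dd k hX' X' := by
  induction hn : Module.finrank k (Y ⟶ Y) using Nat.strong_induction_on generalizing Y with
  | _ n ih =>
  by_cases h : Retr X Y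
  · obtain ⟨Z, hZ⟩ := h.isSum
    have := ih _ (hn ▸ size_lt k hZ hX.1) Z rfl
    rw [dd_isSum k hX hZ, dd_isSum k hX' ((hZ.map F).isoX e), add_mul, add_mul, this, mul_comm]
  · rw [(dd_eq_zero k hX).2 h, (dd_eq_zero k hX').2, zero_mul, zero_mul]
    exact fun h' => h (Retr.of_map F ((Retr.of_iso e).trans h'))

theorem iso_of_dd [IsIdempotentComplete C] (A B : C)
    (h : ∀ (X : C) (hX : Loc X), dd k hX A = dd k hX B) : Nonempty (A ≅ B) := by
  induction hn : Module.finrank k (A ⟶ A) using Nat.strong_induction_on generalizing A B with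
  | _ n ih =>
  by_cases hA : ∃ X, Loc X ∧ Retr X A
  · obtain ⟨X, hX, hXA⟩ := hA
    have hXB : Retr X B := by
      by_contra hc
      rw [← dd_eq_zero k hX, ← h, dd_eq_zero] at hc
      exact hc hXA
    obtain ⟨A', hA'⟩ := hXA.isSum
    obtain ⟨B', hB'⟩ := hXB.isSum
    obtain ⟨e⟩ := ih _ (hn ▸ size_lt k hA' hX.1) A' B' (fun Y hY => by
      have := h Y hY
      rw [dd_isSum k hY hA', dd_isSum k hY hB'] at this
      omega) rfl
    exact hA'.iso hB' e
  · have hA0 : IsZero A := by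
      by_contra hc
      exact hA (exists_loc k A hc)
    have hB0 : IsZero B := by
      by_contra hc
      obtain ⟨X, hX, hXB⟩ := exists_loc k B hc
      apply hA
      refine ⟨X, hX, ?_⟩
      by_contra hc
      rw [← dd_eq_zero k hX, h, dd_eq_zero] at hc
      exact hc hXB
    exact ⟨hA0.iso hB0⟩

theorem finite_support [IsIdempotentComplete C] {I : Type*} (X : I → C) (hX : ∀ i, Loc (X i))
    (hne : ∀ i j, Nonempty (X i ≅ X j) → i = j) (A : C) :
    {i | dd k (hX i) A ≠ 0}.Finite := by
  induction hn : Module.finrank k (A ⟶ A) using Nat.strong_induction_on generalizing A with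
  | _ n ih =>
  by_cases h : ∃ i, Retr (X i) A
  · obtain ⟨i, hi⟩ := h
    obtain ⟨Z, hZ⟩ := hi.isSum
    refine ((ih _ (hn ▸ size_lt k hZ (hX i).1) Z rfl).union (Set.finite_singleton i)).subset ?_
    intro l hl
    by_cases hlZ : dd k (hX l) Z = 0
    · right
      apply hne
      simp only [Set.mem_setOf_eq] at hl
      rw [dd_isSum k _ hZ, hlZ, add_zero, Ne, dd_eq_zero, not_not] at hl
      exact Loc.iso_of_retr (hX l).1 (hX i) hl
    · left; exact hlZ
  · convert Set.finite_empty
    ext i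
    simp only [Set.mem_setOf_eq, Set.mem_empty_iff_false, iff_false, not_not]
    rw [dd_eq_zero]
    exact fun hh => h ⟨i, hh⟩

end

theorem conv_cancel (a : ℤ → ℕ) (s : Finset ℤ) (hsupp : ∀ j : ℤ, a j ≠ 0 → j ∈ s)
    (hnz : ∃ j : ℤ, a j ≠ 0) (f : ℤ → ℚ) (hf : {i | f i ≠ 0}.Finite)
    (h : ∀ n, ∑ j ∈ s, (a j : ℚ) * f (n - j) = 0) : f = 0 := by
  classical
  by_contra hc
  have hS : hf.toFinset.Nonempty := by
    obtain ⟨i, hi⟩ := Function.ne_iff.1 hc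
    exact ⟨i, by simpa using hi⟩
  have hT : (s.filter (fun j => a j ≠ 0)).Nonempty := by
    obtain ⟨j, hj⟩ := hnz
    exact ⟨j, by simp [hj, hsupp j hj]⟩
  set N := hf.toFinset.max' hS
  set J := (s.filter (fun j => a j ≠ 0)).max' hT
  have hN : f N ≠ 0 := by simpa using hf.toFinset.max'_mem hS
  have hJ := (s.filter (fun j => a j ≠ 0)).max'_mem hT
  rw [Finset.mem_filter] at hJ
  have := h (N + J)
  rw [Finset.sum_eq_single J] at this
  · rw [add_sub_cancel_right] at this
    rcases mul_eq_zero.1 this with h | h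
    · exact hJ.2 (by exact_mod_cast h)
    · exact hN h
  · intro j hj hne
    by_cases haj : a j = 0
    · simp [haj]
    have hle : j ≤ J := Finset.le_max' _ _ (by simp [hj, haj])
    have : f (N + J - j) = 0 := by
      by_contra hc
      have : N + J - j ≤ N := Finset.le_max' _ _ (by simpa using hc)
      omega
    rw [this, mul_zero]
  · intro hh; exact (hh hJ.1).elim

end ShiftCancel

open ShiftCancel in
/-- Cancellation law (4.2): in a `k`-linear, additive, idempotent complete, Hom-finite
category with a shift by `ℤ` such that no nonzero object is isomorphic to a nontrivial
shift of itself, if `⊕_{j ∈ s} (A⟦j⟧)^{⊕ a j} ≅ ⊕_{j ∈ s} (B⟦j⟧)^{⊕ a j}` for a finitely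
supported, not identically zero multiplicity function `a : ℤ → ℕ`, then `A ≅ B`. -/
theorem shifted_copies_cancel
    (k : Type*) [Field k] (𝒞 : Type*) [Category 𝒞] [Preadditive 𝒞]
    [Linear k 𝒞] [HasFiniteBiproducts 𝒞] [IsIdempotentComplete 𝒞]
    [HasShift 𝒞 ℤ]
    (hfin : ∀ X Y : 𝒞, FiniteDimensional k (X ⟶ Y))
    (hshift : ∀ X : 𝒞, ¬ IsZero X → ∀ m : ℤ, Nonempty (X ≅ X⟦m⟧) → m = 0)
    (a : ℤ → ℕ) (s : Finset ℤ) (hsupp : ∀ j : ℤ, a j ≠ 0 → j ∈ s)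
    (hnz : ∃ j : ℤ, a j ≠ 0)
    (A B : 𝒞)
    (h : Nonempty ((⨁ fun j : s => ⨁ fun _ : Fin (a j) => A⟦(j : ℤ)⟧) ≅
        (⨁ fun j : s => ⨁ fun _ : Fin (a j) => B⟦(j : ℤ)⟧))) :
    Nonempty (A ≅ B) := by
  haveI := hfin
  haveI hadd : ∀ m : ℤ, (shiftFunctor 𝒞 m).Additive := fun m =>
    Functor.additive_of_preserves_binary_products _
  obtain ⟨e⟩ := h
  apply iso_of_dd k
  intro X hX
  have hXs : ∀ n : ℤ, Loc (X⟦n⟧) := fun n => hX.map (shiftFunctor 𝒞 n)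
  have hne : ∀ i j : ℤ, Nonempty (X⟦i⟧ ≅ X⟦j⟧) → i = j := by
    rintro i j ⟨u⟩
    have := hshift (X⟦i⟧) (hXs i).1 (j - i)
      ⟨u ≪≫ (shiftFunctorAdd' 𝒞 i (j - i) j (by omega)).app X⟩
    omega
  let m : 𝒞 → ℤ → ℚ := fun Y n => (dd k (hXs n) Y : ℚ) / dd k (hXs n) (X⟦n⟧)
  have hd0 : ∀ n : ℤ, (dd k (hXs n) (X⟦n⟧) : ℚ) ≠ 0 := fun n => by
    exact_mod_cast dd_self k (hXs n)
  have hm : ∀ (Y : 𝒞) (n j : ℤ), m (Y⟦j⟧) n = m Y (n - j) := by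
    intro Y n j
    have := dd_ratio k (shiftFunctor 𝒞 j) (hXs (n - j)) (hXs n)
      ((shiftFunctorAdd' 𝒞 (n - j) j n (by omega)).symm.app X) Y
    simp only [m]
    rw [div_eq_div_iff (hd0 _) (hd0 _)]
    exact_mod_cast this
  have hmsum : ∀ (Y : 𝒞) (n : ℤ),
      m (⨁ fun j : s => ⨁ fun _ : Fin (a j) => Y⟦(j : ℤ)⟧) n
        = ∑ j ∈ s, (a j : ℚ) * m Y (n - j) := by
    intro Y n
    simp only [← hm]
    simp only [m]
    rw [dd_biproduct, ← Finset.sum_coe_sort s]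
    simp only [dd_biproduct]
    push_cast
    rw [Finset.sum_div]
    refine Finset.sum_congr rfl fun j _ => ?_
    simp [mul_div_assoc]
  have hmf : ∀ Y : 𝒞, {i | m Y i ≠ 0}.Finite := by
    intro Y
    refine (finite_support k (fun i : ℤ => X⟦i⟧) hXs hne Y).subset ?_
    intro i hi h0
    apply hi
    simp [m, h0]
  have key := conv_cancel a s hsupp hnz (fun i => m A i - m B i)
    (((hmf A).union (hmf B)).subset (by
      intro i hi
      by_contra hc
      simp only [Set.mem_union, Set.mem_setOf_eq, not_or, not_not] at hc
      apply hi
      simp [hc.1, hc.2])) (by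
      intro n
      simp only [mul_sub, Finset.sum_sub_distrib]
      rw [← hmsum, ← hmsum]
      simp only [m]
      rw [dd_iso k (hXs n) e, sub_self])
  have h0 := congrFun key 0
  simp only [Pi.zero_apply, sub_eq_zero, m] at h0
  rw [div_left_inj' (hd0 0)] at h0
  have h0 : dd k (hXs 0) A = dd k (hXs 0) B := by exact_mod_cast h0
  have hY : ∀ Y : 𝒞, dd k (hXs 0) Y * dd k hX X = dd k hX Y * dd k (hXs 0) (X⟦(0:ℤ)⟧) := fun Y =>
    dd_ratio k (𝟭 𝒞) hX (hXs 0) ((shiftFunctorZero 𝒞 ℤ).symm.app X) Y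
  have := (hY A).symm.trans ((by rw [h0] : _ = _).trans (hY B))
  exact Nat.eq_of_mul_eq_mul_right (Nat.pos_of_ne_zero (dd_self k (hXs 0))) this
end
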